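/- Let {B_t}_{t≥0} be a standard one-dimensional Brownian motion, and let x, b ∈ ℝ with b ≠ x, μ ∈ ℝ and σ > 0 satisfy μ/(b−x) ≥ 0. Set X(t) = x + μt + σB_t and τ_b = inf{t > 0 : X(t) = b}. Then the random variable (μτ_b − (b−x))² / (σ²τ_b) has the χ²(1) distribution. -/

import Mathlib

open MeasureTheory ProbabilityTheory Real

namespace HitChi
open scoped NNReal ENNReal Topology
open Filter

/-- Brownian motion, all of whose paths are continuous and start at `0`. -/
structure BM {Ω : Type*} [MeasurableSpace Ω] (B : ℝ≥0 → Ω → ℝ) (P : Measure Ω) : Prop where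
  pre : IsPreBrownianReal B P
  meas : ∀ t, Measurable (B t)
  cont : ∀ ω, Continuous (fun t => B t ω)
  zero : ∀ ω, B 0 ω = 0

/-- The drifted path. -/
def W {Ω : Type*} (B : ℝ≥0 → Ω → ℝ) (m : ℝ) (t : ℝ≥0) (ω : Ω) : ℝ := B t ω + m * t

/-- The event that the level `a` is hit before time `t`. -/
def E {Ω : Type*} (B : ℝ≥0 → Ω → ℝ) (m a : ℝ) (t : ℝ≥0) : Set Ω :=
  {ω | ∃ s ≤ t, W B m s ω = a}

variable {Ω : Type*} [MeasurableSpace Ω] {B : ℝ≥0 → Ω → ℝ} {P : Measure Ω}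

lemma BM.contW (h : BM B P) (m : ℝ) (ω : Ω) : Continuous (fun t => W B m t ω) := by
  unfold W
  have := h.cont ω
  fun_prop

lemma BM.measW (h : BM B P) (m : ℝ) (t : ℝ≥0) : Measurable (W B m t) := by
  unfold W
  have := h.meas t
  fun_prop

lemma BM.mem_E_of_le (h : BM B P) {m a : ℝ} (ha : 0 < a) {t s : ℝ≥0} (hst : s ≤ t) {ω : Ω}
    (hw : a ≤ W B m s ω) : ω ∈ E B m a t := by
  have h0 : W B m 0 ω = 0 := by simp [W, h.zero]
  obtain ⟨u, hu, hua⟩ := intermediate_value_Icc (zero_le (a := s))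
    (h.contW m ω).continuousOn (show a ∈ Set.Icc (W B m 0 ω) (W B m s ω) from
      ⟨by rw [h0]; exact ha.le, hw⟩)
  exact ⟨u, hu.2.trans hst, hua⟩

lemma BM.past (h : BM B P) {m a : ℝ} (ha : 0 < a) (t : ℝ≥0) :
    ∃ S : Set (Set.Iic t → ℝ), MeasurableSet S ∧
      E B m a t = (fun ω (s : Set.Iic t) => B s ω) ⁻¹' S := by
  obtain ⟨D, hDc, hDd⟩ := TopologicalSpace.exists_countable_dense (Set.Iic t)
  refine ⟨⋂ n : ℕ, ⋃ q ∈ D, {y | a - 1 / ((n : ℝ) + 1) < y q + m * (q : ℝ≥0)}, ?_, ?_⟩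
  · refine MeasurableSet.iInter fun n => MeasurableSet.biUnion hDc fun q _ => ?_
    exact measurableSet_lt measurable_const (by fun_prop)
  · ext ω
    simp only [Set.mem_preimage, Set.mem_iInter, Set.mem_iUnion, Set.mem_ofPred_eq, exists_prop]
    constructor
    · rintro ⟨s, hs, hsa⟩ n
      have hc : Continuous (fun q : Set.Iic t => W B m q ω) :=
        (h.contW m ω).comp continuous_subtype_val
      have ho : IsOpen {q : Set.Iic t | a - 1 / ((n : ℝ) + 1) < W B m q ω} :=
        isOpen_lt continuous_const hc
      obtain ⟨q, hq, hqD⟩ := hDd.exists_mem_open ho ⟨⟨s, hs⟩, by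
        simp only [Set.mem_ofPred_eq, hsa]
        have : (0 : ℝ) < 1 / ((n : ℝ) + 1) := by positivity
        linarith⟩
      exact ⟨q, hq, hqD⟩
    · intro H
      obtain ⟨s, hs, hmax⟩ := (isCompact_Icc (a := (0 : ℝ≥0)) (b := t)).exists_isMaxOn
        ⟨0, by simp⟩ (h.contW m ω).continuousOn
      refine h.mem_E_of_le ha hs.2 ?_
      have h1 : ∀ n : ℕ, a - 1 / ((n : ℝ) + 1) ≤ W B m s ω := fun n => by
        obtain ⟨q, -, hq⟩ := H n
        exact hq.le.trans (hmax (show (q : ℝ≥0) ∈ Set.Icc 0 t from ⟨zero_le, q.2⟩))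
      have h2 : Tendsto (fun n : ℕ => a - 1 / ((n : ℝ) + 1)) atTop (𝓝 (a - 0)) :=
        tendsto_const_nhds.sub tendsto_one_div_add_atTop_nhds_zero_nat
      rw [sub_zero] at h2
      exact le_of_tendsto' h2 h1

lemma BM.past' (h : BM B P) {m a : ℝ} (ha : 0 < a) {u t : ℝ≥0} (hut : u ≤ t) :
    ∃ S : Set (Set.Iic t → ℝ), MeasurableSet S ∧
      E B m a u = (fun ω (s : Set.Iic t) => B s ω) ⁻¹' S := by
  obtain ⟨S, hS, hE⟩ := h.past (m := m) ha u
  refine ⟨(fun y (s : Set.Iic u) => y ⟨s, s.2.trans hut⟩) ⁻¹' S, ?_, ?_⟩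
  · exact (measurable_pi_lambda _ fun s => measurable_pi_apply _) hS
  · rw [hE]; rfl

lemma BM.measE (h : BM B P) {m a : ℝ} (ha : 0 < a) (t : ℝ≥0) : MeasurableSet (E B m a t) := by
  obtain ⟨S, hS, hE⟩ := h.past (m := m) ha t
  rw [hE]
  exact (measurable_pi_lambda _ fun s => h.meas _) hS

lemma E_mono {Ω : Type*} {B : ℝ≥0 → Ω → ℝ} {m a : ℝ} {s t : ℝ≥0} (hst : s ≤ t) : E B m a s ⊆ E B m a t :=
  fun _ ⟨u, hu, h⟩ => ⟨u, hu.trans hst, h⟩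

/-- The law of `W t`. -/
lemma BM.mapW (h : BM B P) (m : ℝ) (t : ℝ≥0) : P.map (W B m t) = gaussianReal (m * t) t := by
  have := gaussianReal_add_const (h.pre.hasLaw_eval t) (m * t)
  rw [zero_add] at this
  exact this.map_eq

lemma std (m : ℝ) (t : ℝ≥0) :
    gaussianReal m t = (gaussianReal 0 1).map (fun z => m + √t * z) := by
  have h1 : (fun z => m + √(t : ℝ) * z) = (fun z => m + z) ∘ (fun z => √(t : ℝ) * z) := rfl
  rw [h1, ← Measure.map_map (by fun_prop) (by fun_prop), gaussianReal_map_const_mul,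
    gaussianReal_map_const_add]
  simp

/-- The transition operator. -/
noncomputable def G (m : ℝ) (f : ℝ → ℝ) (r : ℝ) (y : ℝ) : ℝ :=
  ∫ z, f (y + m * r + √r * z) ∂(gaussianReal 0 1)

lemma measG {m : ℝ} {f : ℝ → ℝ} (hf : Measurable f) (r : ℝ) : Measurable (G m f r) := by
  unfold G
  apply StronglyMeasurable.measurable
  apply StronglyMeasurable.integral_prod_right (f := fun y z => f (y + m * r + √r * z))
  apply Measurable.stronglyMeasurable
  fun_prop

lemma bddG {m : ℝ} {f : ℝ → ℝ} (hb : ∀ y, |f y| ≤ 1) (r y : ℝ) : |G m f r y| ≤ 1 := by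
  have := norm_integral_le_of_norm_le_const (μ := gaussianReal 0 1)
    (f := fun z => f (y + m * r + √r * z)) (C := 1) (ae_of_all _ fun z => hb _)
  simpa [G] using this

/-- Markov property. -/
lemma BM.markov (h : BM B P) [IsProbabilityMeasure P] (m : ℝ) {s t : ℝ≥0} (hst : s ≤ t)
    {f : ℝ → ℝ} (hf : Measurable f) (hb : ∀ y, |f y| ≤ 1) (S : Set (Set.Iic s → ℝ))
    (hS : MeasurableSet S) :
    ∫ ω in (fun ω (u : Set.Iic s) => B u ω) ⁻¹' S, f (W B m t ω) ∂P =
    ∫ ω in (fun ω (u : Set.Iic s) => B u ω) ⁻¹' S, G m f (t - s) (W B m s ω) ∂P := by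
  have hV : Measurable (fun ω (u : Set.Iic s) => B u ω) := measurable_pi_lambda _ fun s => h.meas _
  have hU : Measurable (fun ω => B t ω - B s ω) := (h.meas t).sub (h.meas s)
  set V := (fun ω (u : Set.Iic s) => B u ω) with hVdef
  have hts : s + (t - s) = t := add_tsub_cancel_of_le hst
  have hind : IndepFun (fun ω => B t ω - B s ω) V P := by
    have hφ : Measurable (fun y : ℝ≥0 → ℝ => y (t - s)) := measurable_pi_apply (t - s)
    have := (h.pre.indepFun_shift s).comp hφ measurable_id
    simpa only [Function.comp_def, hts, id_eq] using this
  have hlaw : P.map (fun ω => B t ω - B s ω) =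
      (gaussianReal 0 1).map (fun z => 0 + √((t - s : ℝ≥0) : ℝ) * z) := by
    have := ((h.pre.shift s).hasLaw_eval (t - s)).map_eq
    simp only [hts] at this
    rw [this, std]
  have hmap := (indepFun_iff_map_prod_eq_prod_map_map hU.aemeasurable hV.aemeasurable).1 hind
  have : IsProbabilityMeasure (P.map V) := Measure.isProbabilityMeasure_map hV.aemeasurable
  have hcast : ((t - s : ℝ≥0) : ℝ) = t - s := NNReal.coe_sub hst
  let Φ : ℝ × (Set.Iic s → ℝ) → ℝ := fun p =>
    S.indicator (fun v => f (p.1 + v ⟨s, le_refl s⟩ + m * t)) p.2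
  have hΦ : Measurable Φ := by
    have h1 : Φ = (Prod.snd ⁻¹' S).indicator
      (fun p : ℝ × (Set.Iic s → ℝ) => f (p.1 + p.2 ⟨s, le_refl s⟩ + m * t)) := rfl
    rw [h1]
    refine Measurable.indicator ?_ (measurable_snd hS)
    fun_prop
  have hΦb : ∀ p, ‖Φ p‖ ≤ 1 := fun p => by
    simp only [Φ, Set.indicator]
    split_ifs
    · exact hb _
    · simp
  have hint : Integrable Φ ((P.map (fun ω => B t ω - B s ω)).prod (P.map V)) := by
    rw [← hmap]
    have : IsProbabilityMeasure (P.map (fun ω => (B t ω - B s ω, V ω))) :=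
      Measure.isProbabilityMeasure_map (hU.prodMk hV).aemeasurable
    exact Integrable.of_bound hΦ.aestronglyMeasurable 1 (ae_of_all _ hΦb)
  have hSm := hV hS
  have : IsProbabilityMeasure (P.map (fun ω => B t ω - B s ω)) :=
      Measure.isProbabilityMeasure_map hU.aemeasurable
  calc _ = ∫ ω, Φ (B t ω - B s ω, V ω) ∂P := by
        rw [← integral_indicator hSm]
        refine integral_congr_ae (ae_of_all _ fun ω => ?_)
        simp only [Φ, Set.indicator, W, Set.mem_preimage, hVdef]
        simp
        rfl
    _ = ∫ p, Φ p ∂((P.map (fun ω => B t ω - B s ω)).prod (P.map V)) := by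
        rw [← hmap, integral_map (hU.prodMk hV).aemeasurable hΦ.aestronglyMeasurable]
    _ = ∫ v, ∫ u, Φ (u, v) ∂(P.map (fun ω => B t ω - B s ω)) ∂(P.map V) :=
        integral_prod_symm _ hint
    _ = ∫ v, S.indicator (fun v => G m f (t - s) (v ⟨s, le_refl s⟩ + m * s)) v ∂(P.map V) := by
        refine integral_congr_ae (ae_of_all _ fun v => ?_)
        simp only
        rw [hlaw, integral_map (by fun_prop) (by
          apply Measurable.aestronglyMeasurable
          fun_prop)]
        simp only [Φ, Set.indicator, G]
        split_ifs
        · congr 1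
          ext z
          rw [hcast]
          congr 1
          ring
        · simp
    _ = _ := by
        rw [integral_map hV.aemeasurable (by
          apply Measurable.aestronglyMeasurable
          refine Measurable.indicator ?_ hS
          exact (measG hf _).comp (by fun_prop)), ← integral_indicator hSm]
        rfl

/-- The test function. -/
noncomputable def fm (m y : ℝ) : ℝ := if y < 0 then 1 else if 0 < y then -exp (-2 * m * y) else 0

lemma measfm (m : ℝ) : Measurable (fm m) := by
  unfold fm
  refine Measurable.ite measurableSet_Iio measurable_const ?_
  exact Measurable.ite measurableSet_Ioi (by fun_prop) measurable_const

lemma bddfm {m : ℝ} (hm : 0 ≤ m) (y : ℝ) : |fm m y| ≤ 1 := by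
  unfold fm
  split_ifs with h1 h2
  · simp
  · rw [abs_neg, abs_of_pos (exp_pos _), exp_le_one_iff]
    nlinarith [mul_nonneg hm h2.le]
  · simp

lemma contfm (m : ℝ) {y : ℝ} (hy : y ≠ 0) : ContinuousAt (fm m) y := by
  rcases lt_or_gt_of_ne hy with h | h
  · refine (continuousAt_const (y := (1 : ℝ))).congr ?_
    filter_upwards [Iio_mem_nhds h] with z hz
    have : z < 0 := hz
    simp [fm, this]
  · have : ContinuousAt (fun y => -exp (-2 * m * y)) y := by fun_prop
    refine this.congr ?_
    filter_upwards [Ioi_mem_nhds h] with z hz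
    have h1 : 0 < z := hz
    simp [fm, h1, h1.not_gt]

lemma pdf_tilt (m : ℝ) {v : ℝ≥0} (hv : v ≠ 0) (y : ℝ) :
    exp (-2 * m * y) * gaussianPDFReal (m * v) v y = gaussianPDFReal (-(m * v)) v y := by
  have hv' : (v : ℝ) ≠ 0 := by exact_mod_cast hv
  rw [gaussianPDFReal, gaussianPDFReal, mul_left_comm, ← exp_add]
  congr 2
  field_simp
  ring

lemma pdf_refl (c : ℝ) (v : ℝ≥0) (y : ℝ) :
    gaussianPDFReal c v (-y) = gaussianPDFReal (-c) v y := by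
  rw [gaussianPDFReal, gaussianPDFReal]
  congr 3
  ring

lemma integral_fm (m : ℝ) {v : ℝ≥0} (hv : v ≠ 0) : ∫ y, fm m y ∂(gaussianReal (m * v) v) = 0 := by
  rw [integral_gaussianReal_eq_integral_smul hv]
  set h : ℝ → ℝ := fun y => gaussianPDFReal (m * v) v y • fm m y with hh
  have hodd : ∀ y, h (-y) = - h y := by
    have hpos : ∀ y, 0 < y → h (-y) = - h y := fun y hy => by
      simp only [hh, smul_eq_mul, fm, hy, hy.not_gt, neg_lt_zero, if_true, if_false, mul_one]
      rw [pdf_refl, ← pdf_tilt m hv]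
      ring
    intro y
    rcases lt_trichotomy y 0 with hy | hy | hy
    · have := hpos (-y) (by linarith)
      rw [neg_neg] at this
      linarith
    · subst hy
      simp [hh, fm]
    · exact hpos y hy
  have h1 := integral_neg_eq_self h volume
  simp_rw [hodd] at h1
  rw [integral_neg] at h1
  linarith

lemma G_zero (m a : ℝ) {r : ℝ} (hr : 0 < r) : G m (fun x => fm m (x - a)) r a = 0 := by
  have hv : r.toNNReal ≠ 0 := by simpa using hr
  have h := integral_fm m hv
  rw [std, integral_map (by fun_prop) (measfm m).aestronglyMeasurable,
    Real.coe_toNNReal _ hr.le] at h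
  rw [← h, G]
  congr 1
  ext z
  congr 1
  ring

lemma G_tendsto {m : ℝ} (hm : 0 ≤ m) (a : ℝ) {r : ℝ} (hr : 0 < r) :
    Tendsto (fun p : ℝ × ℝ => G m (fun x => fm m (x - a)) p.1 p.2) (𝓝 (r, a)) (𝓝 0) := by
  rw [← G_zero m a hr]
  unfold G
  refine tendsto_integral_filter_of_dominated_convergence (fun _ => 1) ?_ ?_ ?_ ?_
  · refine Eventually.of_forall fun p => ?_
    have := measfm m
    exact Measurable.aestronglyMeasurable (by fun_prop)
  · exact Eventually.of_forall fun p => ae_of_all _ fun z => bddfm hm _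
  · exact integrable_const _
  · have : NullSingletonClass (gaussianReal 0 1) := nullSingletonClass_gaussianReal one_ne_zero
    have hne : ∀ᵐ z ∂(gaussianReal 0 1), z ≠ -(m * r) / √r := by
      rw [ae_iff]
      simp
    filter_upwards [hne] with z hz
    have hs : 0 < √r := sqrt_pos.2 hr
    have hy : a + m * r + √r * z - a ≠ 0 := fun h => hz (by
      field_simp
      linarith)
    have hc : ContinuousAt (fun p : ℝ × ℝ => p.2 + m * p.1 + √p.1 * z - a) (r, a) := by fun_prop
    exact (ContinuousAt.comp (f := fun p : ℝ × ℝ => p.2 + m * p.1 + √p.1 * z - a)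
      (g := fm m) (contfm m hy) hc)

lemma BM.null (h : BM B P) (m a : ℝ) {t : ℝ≥0} (ht : 0 < t) : ∀ᵐ ω ∂P, W B m t ω ≠ a := by
  have : NullSingletonClass (gaussianReal (m * t) t) := nullSingletonClass_gaussianReal ht.ne'
  have h1 : ∀ᵐ z ∂(gaussianReal (m * t) t), z ≠ a := by
    rw [ae_iff]
    simp
  rw [← h.mapW] at h1
  exact ae_of_ae_map (h.measW m t).aemeasurable h1

lemma BM.exists_first (h : BM B P) {m a : ℝ} {t : ℝ≥0} {ω : Ω}
    (hω : ω ∈ E B m a t) : ∃ τ ≤ t, W B m τ ω = a ∧ ∀ s, ω ∈ E B m a s ↔ τ ≤ s := by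
  obtain ⟨s, hs, hsa⟩ := hω
  have hcl : IsClosed {s | W B m s ω = a} := isClosed_eq (h.contW m ω) continuous_const
  have hsa' : s ∈ {s | W B m s ω = a} := hsa
  have hmem := hcl.csInf_mem ⟨s, hsa'⟩ (OrderBot.bddBelow _)
  refine ⟨sInf {s | W B m s ω = a}, (csInf_le (OrderBot.bddBelow _) hsa').trans hs, hmem,
    fun u => ⟨?_, fun hu => ⟨_, hu, hmem⟩⟩⟩
  rintro ⟨v, hv, hva⟩
  have hva' : v ∈ {s | W B m s ω = a} := hva
  exact (csInf_le (OrderBot.bddBelow _) hva').trans hv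

lemma BM.key (h : BM B P) [IsProbabilityMeasure P] {m a : ℝ} (hm : 0 ≤ m) (ha : 0 < a)
    {t : ℝ≥0} (ht : 0 < t) : ∫ ω in E B m a t, fm m (W B m t ω - a) ∂P = 0 := by
  set f : ℝ → ℝ := fun x => fm m (x - a) with hf
  have hfm : Measurable f := (measfm m).comp (by fun_prop)
  have hfb : ∀ y, |f y| ≤ 1 := fun y => bddfm hm _
  let T : ℕ → ℕ → ℝ≥0 := fun n k => k * t / (n + 1)
  have hT1 : ∀ n k, T n k ≤ T n (k + 1) := fun n k => by
    simp only [T]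
    gcongr
    simp
  have hTt : ∀ n, T n (n + 1) = t := fun n => by
    simp only [T]
    push_cast
    field_simp
  have hT0 : ∀ n, T n 0 = 0 := fun n => by simp [T]
  have hTle : ∀ n k, k < n + 1 → T n (k + 1) ≤ t := fun n k hk => by
    have : T n (k + 1) ≤ T n (n + 1) := by
      simp only [T]
      gcongr
      omega
    rwa [hTt] at this
  have hE0 : E B m a 0 = ∅ := by
    ext ω
    simp only [E, Set.mem_empty_iff_false, iff_false]
    rintro ⟨s, hs, hsa⟩
    have : s = 0 := le_antisymm hs zero_le
    subst this
    simp [W, h.zero] at hsa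
    linarith
  let A : ℕ → ℕ → Set Ω := fun n k => E B m a (T n (k + 1)) \ E B m a (T n k)
  have hAm : ∀ n k, MeasurableSet (A n k) := fun n k => (h.measE ha _).diff (h.measE ha _)
  have hAind : ∀ n k (φ : Ω → ℝ) ω, (A n k).indicator φ ω =
      (E B m a (T n (k + 1))).indicator φ ω - (E B m a (T n k)).indicator φ ω := fun n k φ ω => by
    have := E_mono (B := B) (m := m) (a := a) (hT1 n k)
    by_cases h1 : ω ∈ E B m a (T n k)
    · simp [A, h1, this h1]
    · by_cases h2 : ω ∈ E B m a (T n (k + 1)) <;> simp [A, h1, h2]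
  have hsum : ∀ n (φ : Ω → ℝ) ω,
      (E B m a t).indicator φ ω = ∑ k ∈ Finset.range (n + 1), (A n k).indicator φ ω :=
    fun n φ ω => by
      simp_rw [hAind]
      rw [Finset.sum_range_sub (fun k => (E B m a (T n k)).indicator φ ω), hTt, hT0, hE0]
      simp
  let R : ℕ → Ω → ℝ := fun n ω => ∑ k ∈ Finset.range (n + 1),
    (A n k).indicator (fun ω => G m f (t - T n (k + 1)) (W B m (T n (k + 1)) ω)) ω
  have hRm : ∀ n k, Measurable
      (fun ω => G m f (t - T n (k + 1)) (W B m (T n (k + 1)) ω)) :=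
    fun n k => (measG hfm _).comp (h.measW m _)
  have hRb : ∀ n ω C, 0 ≤ C → (∀ k < n + 1, ω ∈ A n k →
      |G m f (t - T n (k + 1)) (W B m (T n (k + 1)) ω)| ≤ C) → |R n ω| ≤ C := by
    intro n ω C hC hk
    calc |R n ω| ≤ ∑ k ∈ Finset.range (n + 1), |(A n k).indicator
            (fun ω => G m f (t - T n (k + 1)) (W B m (T n (k + 1)) ω)) ω| :=
          Finset.abs_sum_le_sum_abs _ _
      _ ≤ ∑ k ∈ Finset.range (n + 1), (A n k).indicator (fun _ => C) ω := by
          refine Finset.sum_le_sum fun k hkr => ?_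
          by_cases hA : ω ∈ A n k
          · simpa [hA] using hk k (Finset.mem_range.1 hkr) hA
          · simp [hA]
      _ = (E B m a t).indicator (fun _ => C) ω := (hsum n _ ω).symm
      _ ≤ C := Set.indicator_le_self' (fun _ _ => hC) ω
  have hInt : ∀ n, ∫ ω in E B m a t, f (W B m t ω) ∂P = ∫ ω, R n ω ∂P := by
    intro n
    have hfi : ∀ k, Integrable ((A n k).indicator (fun ω => f (W B m t ω))) P := fun k =>
      (Integrable.of_bound (hfm.comp (h.measW m t)).aestronglyMeasurable 1
        (ae_of_all _ fun ω => hfb _)).indicator (hAm n k)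
    have hgi : ∀ k, Integrable ((A n k).indicator
        (fun ω => G m f (t - T n (k + 1)) (W B m (T n (k + 1)) ω))) P := fun k =>
      (Integrable.of_bound (hRm n k).aestronglyMeasurable 1
        (ae_of_all _ fun ω => bddG hfb _ _)).indicator (hAm n k)
    rw [← integral_indicator (h.measE ha t)]
    simp_rw [hsum n]
    rw [integral_finsetSum _ (fun k _ => hfi k), integral_finsetSum _ (fun k _ => hgi k)]
    refine Finset.sum_congr rfl fun k hk => ?_
    rw [integral_indicator (hAm n k), integral_indicator (hAm n k)]
    obtain ⟨S1, hS1, hE1⟩ := h.past (m := m) ha (T n (k + 1))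
    obtain ⟨S2, hS2, hE2⟩ := h.past' (m := m) ha (hT1 n k)
    have hA : A n k = (fun ω (s : Set.Iic (T n (k + 1))) => B s ω) ⁻¹' (S1 \ S2) := by
      simp only [A, hE1, hE2, Set.preimage_sdiff]
    rw [hA]
    exact h.markov m (hTle n k (Finset.mem_range.1 hk)) hfm hfb _ (hS1.diff hS2)
  have hlim : Tendsto (fun n => ∫ ω, R n ω ∂P) atTop (𝓝 (∫ ω, (0 : ℝ) ∂P)) := by
    refine tendsto_integral_of_dominated_convergence (fun _ => 1) ?_ (integrable_const _) ?_ ?_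
    · intro n
      apply Measurable.aestronglyMeasurable
      exact Finset.measurable_sum _ fun k _ => (hRm n k).indicator (hAm n k)
    · exact fun n => ae_of_all _ fun ω => hRb n ω 1 zero_le_one fun k _ _ => bddG hfb _ _
    · filter_upwards [h.null m a ht] with ω hω
      by_cases hE : ω ∈ E B m a t
      · obtain ⟨τ, hτt, hτa, hτ⟩ := h.exists_first hE
        have hlt : τ < t := lt_of_le_of_ne hτt fun h' => hω (h' ▸ hτa)
        have hpos : (0 : ℝ) < t - τ := sub_pos.2 (by exact_mod_cast hlt)
        have hc : Tendsto (fun s : ℝ≥0 => ((t : ℝ) - s, W B m s ω)) (𝓝 τ) (𝓝 (t - τ, a)) := by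
          have h1 : Continuous (fun s : ℝ≥0 => ((t : ℝ) - s, W B m s ω)) := by
            have := h.contW m ω
            fun_prop
          have := h1.tendsto τ
          rwa [hτa] at this
        have hG := (G_tendsto hm a hpos).comp hc
        rw [Metric.tendsto_atTop]
        intro ε hε
        obtain ⟨δ, hδ, hδG⟩ := Metric.tendsto_nhds_nhds.1 hG (ε / 2) (half_pos hε)
        obtain ⟨N, hN⟩ := exists_nat_gt ((t : ℝ) / δ)
        refine ⟨N, fun n hn => ?_⟩
        rw [Real.dist_eq, sub_zero]
        refine lt_of_le_of_lt (hRb n ω (ε / 2) (half_pos hε).le fun k _ hA => ?_) (half_lt_self hε)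
        have h1 : τ ≤ T n (k + 1) := (hτ _).1 hA.1
        have h2 : T n k < τ := not_le.1 fun h' => hA.2 ((hτ _).2 h')
        have h1' : (τ : ℝ) ≤ (k + 1) * t / (n + 1) := by
          have := NNReal.coe_le_coe.2 h1
          simpa [T] using this
        have h2' : (k : ℝ) * t / (n + 1) < τ := by
          have := NNReal.coe_lt_coe.2 h2
          simpa [T] using this
        have h3 : dist (T n (k + 1)) τ < δ := by
          rw [NNReal.dist_eq]
          have : ((T n (k + 1) : ℝ≥0) : ℝ) = (k + 1) * t / (n + 1) := by simp [T]
          rw [this, abs_of_nonneg (by linarith)]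
          have h4 : ((k : ℝ) + 1) * t / (n + 1) = k * t / (n + 1) + t / (n + 1) := by ring
          have h5 : (t : ℝ) / (n + 1) < δ := by
            rw [div_lt_iff₀ (by positivity)]
            rw [div_lt_iff₀ hδ] at hN
            have : (N : ℝ) ≤ n := by exact_mod_cast hn
            nlinarith
          linarith
        have := hδG h3
        rw [Real.dist_eq, sub_zero] at this
        exact this.le
      · have : ∀ n, R n ω = 0 := fun n => by
          have := hRb n ω 0 le_rfl fun k hk hA => absurd (E_mono (hTle n k hk) hA.1) hE
          simpa using this
        simp [this]
  have := tendsto_nhds_unique (tendsto_const_nhds.congr hInt) hlim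
  simpa using this

/-- The Gaussian tail. -/
noncomputable def Q (c : ℝ) : ℝ := (gaussianReal 0 1).real (Set.Ici c)

lemma nsc1 : NullSingletonClass (gaussianReal 0 1) := nullSingletonClass_gaussianReal one_ne_zero

lemma gtail (c a : ℝ) {t : ℝ≥0} (ht : 0 < t) :
    (gaussianReal c t).real (Set.Ici a) = Q ((a - c) / √t) := by
  have hs : 0 < √(t : ℝ) := sqrt_pos.2 (by exact_mod_cast ht)
  rw [std, Q, map_measureReal_apply (by fun_prop) measurableSet_Ici]
  congr 1
  ext z
  simp only [Set.mem_preimage, Set.mem_Ici]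
  rw [div_le_iff₀ hs]
  constructor <;> intro h <;> linarith

lemma Q_neg (c : ℝ) : Q (-c) = 1 - Q c := by
  have := nsc1
  have h1 : Q (-c) = (gaussianReal 0 1).real (Set.Iic c) := by
    have h2 : (gaussianReal 0 1).map (fun x => -x) = gaussianReal 0 1 := by
      rw [gaussianReal_map_neg, neg_zero]
    rw [Q]
    nth_rw 1 [← h2]
    rw [map_measureReal_apply (by fun_prop) measurableSet_Ici]
    congr 1
    ext z
    simp
  have h3 : Q c = (gaussianReal 0 1).real (Set.Ioi c) := by
    rw [Q, measureReal_congr Ioi_ae_eq_Ici]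
  rw [h1, h3, ← Set.compl_Iic, probReal_compl_eq_one_sub measurableSet_Iic]
  ring

lemma Q_sub_le {x y : ℝ} (hxy : x ≤ y) : Q x - Q y ≤ y - x := by
  have h1 : (gaussianReal 0 1).real (Set.Ico x y) = Q x - Q y := by
    rw [← Set.Ici_sdiff_Ici, measureReal_sdiff (Set.Ici_subset_Ici.2 hxy) measurableSet_Ici]
    rfl
  have h2 : gaussianReal 0 1 (Set.Ico x y) ≤ volume (Set.Ico x y) := by
    rw [gaussianReal_apply _ one_ne_zero]
    calc ∫⁻ z in Set.Ico x y, gaussianPDF 0 1 z ≤ ∫⁻ z in Set.Ico x y, 1 := by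
          refine lintegral_mono fun z => ?_
          rw [gaussianPDF, ENNReal.ofReal_le_one, gaussianPDFReal]
          have h3 : (√(2 * π * ((1 : ℝ≥0) : ℝ)))⁻¹ ≤ 1 := by
            apply inv_le_one_of_one_le₀
            rw [Real.one_le_sqrt]
            have := Real.pi_gt_three
            simp
            linarith
          have h4 : rexp (-(z - 0) ^ 2 / (2 * ((1 : ℝ≥0) : ℝ))) ≤ 1 := by
            rw [exp_le_one_iff]
            simp
            nlinarith [sq_nonneg z]
          exact mul_le_one₀ h3 (exp_pos _).le h4
      _ = _ := by simp
  rw [← h1]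
  rw [Real.volume_Ico] at h2
  exact ENNReal.toReal_le_of_le_ofReal (by linarith) h2

lemma Icc_eq {c : ℝ} (hc : 0 ≤ c) :
    (gaussianReal 0 1).real (Set.Icc (-c) c) = Q (-c) - Q c := by
  have := nsc1
  rw [← measureReal_congr Ico_ae_eq_Icc, ← Set.Ici_sdiff_Ici,
    measureReal_sdiff (Set.Ici_subset_Ici.2 (by linarith)) measurableSet_Ici]
  rfl

lemma tilt_int (m a : ℝ) {t : ℝ≥0} (ht : 0 < t) :
    ∫ y, (Set.Ioi a).indicator (fun y => exp (-2 * m * (y - a))) y ∂(gaussianReal (m * t) t) =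
      exp (2 * m * a) * Q ((a + m * t) / √t) := by
  have := nullSingletonClass_gaussianReal (μ := -(m * t)) ht.ne'
  rw [integral_gaussianReal_eq_integral_smul ht.ne']
  have h1 : Q ((a + m * t) / √t) = (gaussianReal (-(m * t)) t).real (Set.Ioi a) := by
    rw [measureReal_congr Ioi_ae_eq_Ici, gtail _ _ ht, sub_neg_eq_add]
  rw [h1, measureReal_def, gaussianReal_apply_eq_integral _ ht.ne',
    ENNReal.toReal_ofReal (setIntegral_nonneg measurableSet_Ioi
      fun y _ => gaussianPDFReal_nonneg _ _ _),
    ← integral_const_mul, ← integral_indicator measurableSet_Ioi]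
  congr 1
  ext y
  simp only [Set.indicator, smul_eq_mul]
  split_ifs
  · rw [← pdf_tilt m ht.ne', ← mul_assoc, ← exp_add, mul_comm]
    congr 2
    ring
  · simp

lemma BM.cdf (h : BM B P) [IsProbabilityMeasure P] {m a : ℝ} (hm : 0 ≤ m) (ha : 0 < a)
    {t : ℝ≥0} (ht : 0 < t) : P.real (E B m a t) =
      Q ((a - m * t) / √t) + exp (2 * m * a) * Q ((a + m * t) / √t) := by
  have hk := h.key hm ha ht
  have hW := h.measW m t
  rw [← integral_indicator (h.measE ha t)] at hk
  have hkm : Measurable ((Set.Ioi a).indicator (fun y => exp (-2 * m * (y - a)))) :=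
    Measurable.indicator (by fun_prop) measurableSet_Ioi
  have hm1 : Measurable ((E B m a t).indicator (fun ω => fm m (W B m t ω - a))) :=
    Measurable.indicator ((measfm m).comp (by fun_prop)) (h.measE ha t)
  have hpt : ∀ ω, (E B m a t).indicator (fun _ => (1 : ℝ)) ω =
      (E B m a t).indicator (fun ω => fm m (W B m t ω - a)) ω +
      ((W B m t ⁻¹' Set.Ici a).indicator (fun _ => (1 : ℝ)) ω +
      (Set.Ioi a).indicator (fun y => exp (-2 * m * (y - a))) (W B m t ω)) := by
    intro ω
    rcases lt_or_ge (W B m t ω) a with hlt | hge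
    · by_cases hE : ω ∈ E B m a t <;>
        simp [hE, Set.indicator, fm, hlt, hlt.not_ge, hlt.not_gt]
    · have hE : ω ∈ E B m a t := h.mem_E_of_le ha le_rfl hge
      rcases hge.eq_or_lt with heq | hgt
      · simp [hE, Set.indicator, fm, ← heq]
      · simp [hE, Set.indicator, fm, hgt, hge, hgt.not_gt]
  have i1 : Integrable ((E B m a t).indicator (fun ω => fm m (W B m t ω - a))) P := by
    refine Integrable.of_bound hm1.aestronglyMeasurable 1 (ae_of_all _ fun ω => ?_)
    rw [Set.indicator]
    split_ifs
    · exact bddfm hm _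
    · simp
  have i2 : Integrable ((W B m t ⁻¹' Set.Ici a).indicator (fun _ => (1 : ℝ))) P :=
    (integrable_const _).indicator (hW measurableSet_Ici)
  have i3 : Integrable
      (fun ω => (Set.Ioi a).indicator (fun y => exp (-2 * m * (y - a))) (W B m t ω)) P := by
    refine Integrable.of_bound (hkm.comp hW).aestronglyMeasurable 1 (ae_of_all _ fun ω => ?_)
    rw [Set.indicator]
    split_ifs with hh
    · rw [Real.norm_eq_abs, abs_of_pos (exp_pos _), exp_le_one_iff]
      have : 0 < W B m t ω - a := sub_pos.2 hh
      nlinarith [mul_nonneg hm this.le]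
    · simp
  have e0 : ∫ ω, (E B m a t).indicator (fun _ => (1 : ℝ)) ω ∂P = P.real (E B m a t) := by
    rw [integral_indicator (h.measE ha t)]
    simp
  have e1 : ∫ ω, (W B m t ⁻¹' Set.Ici a).indicator (fun _ => (1 : ℝ)) ω ∂P =
      Q ((a - m * t) / √t) := by
    rw [integral_indicator (hW measurableSet_Ici), ← gtail _ _ ht, ← h.mapW,
      map_measureReal_apply hW measurableSet_Ici]
    simp
  have e2 : ∫ ω, (Set.Ioi a).indicator (fun y => exp (-2 * m * (y - a))) (W B m t ω) ∂P =
      exp (2 * m * a) * Q ((a + m * t) / √t) := by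
    rw [← tilt_int m a ht, ← h.mapW, integral_map hW.aemeasurable hkm.aestronglyMeasurable]
  have i23 : Integrable (fun ω => (W B m t ⁻¹' Set.Ici a).indicator (fun _ => (1 : ℝ)) ω +
      (Set.Ioi a).indicator (fun y => exp (-2 * m * (y - a))) (W B m t ω)) P := i2.add i3
  rw [← e0, integral_congr_ae (ae_of_all _ hpt), integral_add i1 i23, hk,
    integral_add i2 i3, e1, e2, zero_add]

lemma Q_nonneg (c : ℝ) : 0 ≤ Q c := measureReal_nonneg

/-- The level is hit almost surely. -/
lemma BM.hits (h : BM B P) [IsProbabilityMeasure P] {m a : ℝ} (hm : 0 ≤ m) (ha : 0 < a) :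
    ∀ᵐ ω ∂P, ω ∈ ⋃ n : ℕ, E B m a n := by
  have hmeas : MeasurableSet (⋃ n : ℕ, E B m a n) := MeasurableSet.iUnion fun n => h.measE ha _
  have hlow : ∀ n : ℕ, 1 - 2 * a / √((n + 1 : ℕ) : ℝ) ≤ P.real (⋃ n : ℕ, E B m a n) := by
    intro n
    have hpos : (0 : ℝ≥0) < ((n + 1 : ℕ) : ℝ≥0) := by positivity
    have h1 : P.real (E B m a ((n + 1 : ℕ) : ℝ≥0)) ≤ P.real (⋃ n : ℕ, E B m a n) :=
      measureReal_mono (Set.subset_iUnion (fun n : ℕ => E B m a n) (n + 1))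
    refine le_trans ?_ h1
    rw [h.cdf hm ha hpos]
    simp only [NNReal.coe_natCast]
    set t : ℝ := ((n + 1 : ℕ) : ℝ) with ht
    have htp : 0 < t := by rw [ht]; positivity
    have hs : 0 < √t := sqrt_pos.2 htp
    have h2 := Q_neg ((a + m * t) / √t)
    have h3 : Q (-((a + m * t) / √t)) - Q ((a - m * t) / √t) ≤ 2 * a / √t := by
      have h5 : (a - m * t) / √t - -((a + m * t) / √t) = 2 * a / √t := by
        field_simp
        ring
      have h6 : 0 < 2 * a / √t := by positivity
      have := Q_sub_le (x := -((a + m * t) / √t)) (y := (a - m * t) / √t) (by linarith)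
      linarith
    have h4 : 1 ≤ exp (2 * m * a) := one_le_exp (by positivity)
    nlinarith [Q_nonneg ((a + m * t) / √t)]
  have hlim : Tendsto (fun n : ℕ => 1 - 2 * a / √((n + 1 : ℕ) : ℝ)) atTop (𝓝 (1 - 0)) := by
    refine tendsto_const_nhds.sub (tendsto_const_nhds.div_atTop ?_)
    exact tendsto_sqrt_atTop.comp
      (tendsto_natCast_atTop_atTop.comp (tendsto_add_atTop_nat 1))
  rw [sub_zero] at hlim
  have hge : 1 ≤ P.real (⋃ n : ℕ, E B m a n) := le_of_tendsto' hlim hlow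
  have h1 : P.real (⋃ n : ℕ, E B m a n) = 1 := le_antisymm measureReal_le_one hge
  have h2 : P (⋃ n : ℕ, E B m a n) = 1 := by
    rw [← ofReal_measureReal, h1, ENNReal.ofReal_one]
  exact (mem_ae_iff_prob_eq_one hmeas).2 h2

lemma BM.tau (h : BM B P) {m a : ℝ} (ha : 0 < a) {τ : Ω → ℝ}
    (hτ : ∀ ω, τ ω = sInf {t : ℝ | 0 < t ∧ W B m t.toNNReal ω = a}) {ω : Ω} {t : ℝ≥0}
    (hω : ω ∈ E B m a t) :
    0 < τ ω ∧ (∀ s : ℝ≥0, ω ∈ E B m a s ↔ τ ω ≤ s) ∧ W B m (τ ω).toNNReal ω = a := by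
  obtain ⟨τ', -, hτa, hiff⟩ := h.exists_first hω
  have hne : 0 < τ' := pos_iff_ne_zero.2 fun h0 => by
    subst h0
    simp [W, h.zero] at hτa
    linarith
  have hl : IsLeast {t : ℝ | 0 < t ∧ W B m t.toNNReal ω = a} (τ' : ℝ) := by
    refine ⟨⟨by exact_mod_cast hne, by simpa using hτa⟩, ?_⟩
    rintro s ⟨hs, hsa⟩
    have := (hiff s.toNNReal).1 ⟨_, le_rfl, hsa⟩
    exact (Real.le_toNNReal_iff_coe_le hs.le).1 this
  have heq : τ ω = τ' := by rw [hτ, hl.csInf_eq]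
  rw [heq]
  refine ⟨by exact_mod_cast hne, fun s => by rw [hiff]; exact_mod_cast Iff.rfl, by simpa using hτa⟩

lemma BM.measTau (h : BM B P) {m a : ℝ} (ha : 0 < a) {τ : Ω → ℝ}
    (hτ : ∀ ω, τ ω = sInf {t : ℝ | 0 < t ∧ W B m t.toNNReal ω = a}) : Measurable τ := by
  refine measurable_of_Iic fun x => ?_
  have hnot : ∀ ω, ω ∉ (⋃ n : ℕ, E B m a n) → τ ω = 0 := by
    intro ω hω
    rw [hτ]
    have : {t : ℝ | 0 < t ∧ W B m t.toNNReal ω = a} = ∅ := by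
      ext s
      simp only [Set.mem_empty_iff_false, iff_false]
      rintro ⟨-, hs⟩
      obtain ⟨n, hn⟩ := exists_nat_ge s.toNNReal
      exact hω (Set.mem_iUnion.2 ⟨n, _, hn, hs⟩)
    rw [this, Real.sInf_empty]
  rcases lt_or_ge x 0 with hx | hx
  · convert MeasurableSet.empty
    ext ω
    simp only [Set.mem_preimage, Set.mem_Iic, Set.mem_empty_iff_false, iff_false, not_le]
    by_cases hω : ω ∈ ⋃ n : ℕ, E B m a n
    · obtain ⟨n, hn⟩ := Set.mem_iUnion.1 hω
      exact hx.trans (h.tau ha hτ hn).1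
    · rw [hnot ω hω]
      exact hx
  · have : τ ⁻¹' Set.Iic x = E B m a x.toNNReal ∪ (⋃ n : ℕ, E B m a n)ᶜ := by
      ext ω
      simp only [Set.mem_preimage, Set.mem_Iic, Set.mem_union, Set.mem_compl_iff]
      by_cases hω : ω ∈ ⋃ n : ℕ, E B m a n
      · obtain ⟨n, hn⟩ := Set.mem_iUnion.1 hω
        rw [(h.tau ha hτ hn).2.1, Real.coe_toNNReal _ hx]
        simp [hω]
      · simp [hω, hnot ω hω, hx]
    rw [this]
    exact (h.measE ha _).union (MeasurableSet.iUnion fun n => h.measE ha _).compl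

lemma BM.cdf_sq (h : BM B P) [IsProbabilityMeasure P] {m a : ℝ} (hm : 0 ≤ m) (ha : 0 < a)
    {u : ℝ} (hu : 0 < u) : P.real (E B m a (u ^ 2).toNNReal) =
      Q (a / u - m * u) + exp (2 * m * a) * Q (a / u + m * u) := by
  have hu2 : 0 < u ^ 2 := by positivity
  rw [h.cdf hm ha (by simpa using hu2), Real.coe_toNNReal _ hu2.le, Real.sqrt_sq hu.le]
  congr 3
  · field_simp
  · field_simp

lemma alg1 {m a c u v : ℝ} (hm : 0 ≤ m) (hc : 0 < c) (hu : 0 < u) (hv : 0 < v)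
    (h : m * u ^ 2 + c * u = a) : a ≤ m * v ^ 2 + c * v ↔ u ≤ v := by
  rw [← h]
  constructor
  · intro h1
    by_contra! hlt
    have : m * v ^ 2 ≤ m * u ^ 2 := by gcongr
    nlinarith
  · intro h1
    gcongr

lemma alg2 {m a c u v : ℝ} (hm : 0 < m) (ha : 0 < a) (hu : 0 < u) (hv : 0 < v)
    (h : m * u ^ 2 = a + c * u) : m * v ^ 2 ≤ a + c * v ↔ v ≤ u := by
  have key : u * (a + c * v - m * v ^ 2) = (u - v) * (a + m * u * v) := by
    linear_combination (-v) * h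
  have hp : 0 < a + m * u * v := by positivity
  constructor
  · intro h1
    have : 0 ≤ (u - v) * (a + m * u * v) := by
      rw [← key]
      exact mul_nonneg hu.le (by linarith)
    have := nonneg_of_mul_nonneg_left this hp
    linarith
  · intro h1
    have : 0 ≤ u * (a + c * v - m * v ^ 2) := by
      rw [key]
      exact mul_nonneg (by linarith) hp.le
    have := nonneg_of_mul_nonneg_right this hu
    linarith

lemma exists_u {m a c : ℝ} (hm : 0 ≤ m) (ha : 0 < a) (hc : 0 < c) :
    ∃ u, 0 < u ∧ m * u ^ 2 + c * u = a := by
  set D := √(c ^ 2 + 4 * a * m) with hD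
  have hD2 : D ^ 2 = c ^ 2 + 4 * a * m := Real.sq_sqrt (by positivity)
  have hD0 : 0 ≤ D := Real.sqrt_nonneg _
  refine ⟨2 * a / (c + D), by positivity, ?_⟩
  have : c + D ≠ 0 := by positivity
  field_simp
  linear_combination (-1) * hD2

lemma BM.final (h : BM B P) [IsProbabilityMeasure P] {m a : ℝ} (hm : 0 ≤ m) (ha : 0 < a)
    {τ : Ω → ℝ} (hτ : ∀ ω, τ ω = sInf {t : ℝ | 0 < t ∧ W B m t.toNNReal ω = a}) :
    P.map (fun ω => (m * τ ω - a) ^ 2 / τ ω) = (gaussianReal 0 1).map (fun z => z ^ 2) := by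
  have hτm := h.measTau ha hτ
  have hYm : Measurable (fun ω => (m * τ ω - a) ^ 2 / τ ω) := by fun_prop
  have hgood : ∀ᵐ ω ∂P, 0 < τ ω ∧ (∀ s : ℝ≥0, ω ∈ E B m a s ↔ τ ω ≤ s) ∧
      W B m (τ ω).toNNReal ω = a := by
    filter_upwards [h.hits hm ha] with ω hω
    obtain ⟨n, hn⟩ := Set.mem_iUnion.1 hω
    exact h.tau ha hτ hn
  have hne : ∀ s : ℝ, 0 < s → ∀ᵐ ω ∂P, τ ω ≠ s := by
    intro s hs
    filter_upwards [hgood, h.null m a (t := s.toNNReal) (by simpa using hs)] with ω h1 h2 h3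
    rw [h3] at h1
    exact h2 h1.2.2
  have : IsProbabilityMeasure (P.map (fun ω => (m * τ ω - a) ^ 2 / τ ω)) :=
    Measure.isProbabilityMeasure_map hYm.aemeasurable
  refine Measure.ext_of_Iic _ _ fun y => ?_
  rw [Measure.map_apply hYm measurableSet_Iic, Measure.map_apply (by fun_prop) measurableSet_Iic]
  rcases lt_trichotomy y 0 with hy | hy | hy
  · -- negative level
    have h1 : (fun z : ℝ => z ^ 2) ⁻¹' Set.Iic y = ∅ := by
      ext z
      simp only [Set.mem_preimage, Set.mem_Iic, Set.mem_empty_iff_false, iff_false]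
      nlinarith [sq_nonneg z]
    have h2 : P ((fun ω => (m * τ ω - a) ^ 2 / τ ω) ⁻¹' Set.Iic y) = 0 := by
      rw [measure_eq_zero_iff_ae_notMem]
      filter_upwards [hgood] with ω hω
      simp only [Set.mem_preimage, Set.mem_Iic, not_le]
      have := hω.1
      exact hy.trans_le (by positivity)
    rw [h1, h2, measure_empty]
  · -- zero level
    subst hy
    have := nsc1
    have h1 : (fun z : ℝ => z ^ 2) ⁻¹' Set.Iic 0 = {0} := by
      ext z
      simp only [Set.mem_preimage, Set.mem_Iic, Set.mem_singleton_iff]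
      constructor
      · intro hz
        exact pow_eq_zero_iff two_ne_zero |>.1 (le_antisymm hz (sq_nonneg z))
      · rintro rfl
        simp
    have h2 : P ((fun ω => (m * τ ω - a) ^ 2 / τ ω) ⁻¹' Set.Iic 0) = 0 := by
      have h3 : ∀ᵐ ω ∂P, m * τ ω ≠ a := by
        rcases hm.eq_or_lt with h0 | h0
        · refine ae_of_all _ fun ω => ?_
          rw [← h0, zero_mul]
          exact ha.ne
        · filter_upwards [hne (a / m) (by positivity)] with ω hω h4
          exact hω (by rw [← h4]; field_simp)
      rw [measure_eq_zero_iff_ae_notMem]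
      filter_upwards [hgood, h3] with ω hω h4
      simp only [Set.mem_preimage, Set.mem_Iic, not_le]
      have := hω.1
      have : m * τ ω - a ≠ 0 := sub_ne_zero.2 h4
      positivity
    rw [h1, h2, measure_singleton]
  · -- positive level
    obtain ⟨c, hc, rfl⟩ : ∃ c : ℝ, 0 < c ∧ y = c ^ 2 :=
      ⟨√y, Real.sqrt_pos.2 hy, (Real.sq_sqrt hy.le).symm⟩
    have h1 : (fun z : ℝ => z ^ 2) ⁻¹' Set.Iic (c ^ 2) = Set.Icc (-c) c := by
      ext z
      simp only [Set.mem_preimage, Set.mem_Iic, Set.mem_Icc]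
      rw [sq_le_sq, abs_of_pos hc, abs_le]
    rw [h1]
    suffices hs : P.real ((fun ω => (m * τ ω - a) ^ 2 / τ ω) ⁻¹' Set.Iic (c ^ 2)) =
        (gaussianReal 0 1).real (Set.Icc (-c) c) by
      rw [← ofReal_measureReal, hs, ofReal_measureReal]
    rw [Icc_eq hc.le]
    obtain ⟨u, hu, hua⟩ := exists_u hm ha hc
    have hau : a / u - m * u = c := by
      field_simp
      linarith
    have hF1 := h.cdf_sq hm ha hu
    rw [hau] at hF1
    have hlev : ∀ ω, 0 < τ ω → ((m * τ ω - a) ^ 2 / τ ω ≤ c ^ 2 ↔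
        u ≤ √(τ ω) ∧ m * √(τ ω) ^ 2 ≤ a + c * √(τ ω)) := by
      intro ω hω
      have hsq := Real.sq_sqrt hω.le
      have hsp := Real.sqrt_pos.2 hω
      rw [← alg1 hm hc hu hsp hua, div_le_iff₀ hω]
      nth_rw 2 [← hsq]
      rw [← mul_pow, sq_le_sq, abs_of_pos (mul_pos hc hsp), abs_le, hsq]
      constructor
      · rintro ⟨h2, h3⟩
        constructor <;> linarith
      · rintro ⟨h2, h3⟩
        constructor <;> linarith
    have hu1 : ∀ᵐ ω ∂P, (u ≤ √(τ ω) ↔ ω ∉ E B m a (u ^ 2).toNNReal) := by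
      filter_upwards [hgood, hne (u ^ 2) (by positivity)] with ω hω hω2
      rw [hω.2.1, Real.coe_toNNReal _ (by positivity), Real.le_sqrt' hu, not_le]
      exact ⟨fun h3 => lt_of_le_of_ne h3 hω2.symm, fun h3 => h3.le⟩
    rcases hm.eq_or_lt with h0 | h0
    · -- no drift
      subst h0
      have hset : ((fun ω => (0 * τ ω - a) ^ 2 / τ ω) ⁻¹' Set.Iic (c ^ 2) : Set Ω) =ᵐ[P]
          ((E B 0 a (u ^ 2).toNNReal)ᶜ : Set Ω) := by
        filter_upwards [hgood, hu1] with ω hω h2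
        apply propext
        change (0 * τ ω - a) ^ 2 / τ ω ≤ c ^ 2 ↔ ω ∉ E B 0 a (u ^ 2).toNNReal
        rw [hlev ω hω.1, h2]
        refine and_iff_left ?_
        rw [zero_mul]
        positivity
      rw [measureReal_congr hset, probReal_compl_eq_one_sub (h.measE ha _), hF1, Q_neg]
      have : a / u + 0 * u = c := by linarith
      rw [this]
      simp
      ring
    · -- positive drift
      have hmu : 0 < m * u := by positivity
      set w := a / (m * u) with hw
      have hwp : 0 < w := by positivity
      have hww : m * u * w = a := by rw [hw]; field_simp
      have hwa : m * w ^ 2 = a + c * w := by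
        have h5 : (m * u) * (m * w ^ 2 - (a + c * w)) = 0 := by
          linear_combination (m * w + m * u) * hww - m * w * hua
        have := (mul_eq_zero.1 h5).resolve_left hmu.ne'
        linarith
      have huw : u ≤ w := by
        by_contra! hlt
        have : m * u * w < m * u * u := by gcongr
        nlinarith
      have haw : a / w - m * w = -c := by
        field_simp
        linarith
      have haw2 : a / w + m * w = a / u + m * u := by
        have e1 : a / w = m * u := by rw [div_eq_iff hwp.ne', hww]
        have e2 : a / u = m * w := by rw [div_eq_iff hu.ne', ← hww]; ring
        rw [e1, e2]
        ring
      have hF2 := h.cdf_sq hm ha hwp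
      rw [haw, haw2] at hF2
      have hsub : E B m a (u ^ 2).toNNReal ⊆ E B m a (w ^ 2).toNNReal :=
        E_mono (Real.toNNReal_le_toNNReal (by gcongr))
      have hset : ((fun ω => (m * τ ω - a) ^ 2 / τ ω) ⁻¹' Set.Iic (c ^ 2) : Set Ω) =ᵐ[P]
          (E B m a (w ^ 2).toNNReal \ E B m a (u ^ 2).toNNReal : Set Ω) := by
        filter_upwards [hgood, hu1] with ω hω h2
        apply propext
        change (m * τ ω - a) ^ 2 / τ ω ≤ c ^ 2 ↔
          ω ∈ E B m a (w ^ 2).toNNReal ∧ ω ∉ E B m a (u ^ 2).toNNReal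
        rw [hlev ω hω.1, h2, and_comm, alg2 h0 ha hwp (Real.sqrt_pos.2 hω.1) hwa,
          hω.2.1 (w ^ 2).toNNReal, Real.coe_toNNReal _ (by positivity), Real.sqrt_le_left hwp.le]
      rw [measureReal_congr hset, measureReal_sdiff hsub (h.measE ha _), hF1, hF2]
      ring

end HitChi

/-- The case of a positive barrier, for unit volatility. -/
theorem HitChi.pos_case {Ω : Type*} [MeasurableSpace Ω] (P : Measure Ω) [IsProbabilityMeasure P]
    (B : ℝ → Ω → ℝ)
    (hBmeas : ∀ t, Measurable (B t))
    (hB0 : ∀ᵐ ω ∂P, B 0 ω = 0)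
    (hBindep : ∀ (n : ℕ) (t : Fin (n + 1) → ℝ), (∀ i, 0 ≤ t i) → Monotone t →
      iIndepFun
        (fun i : Fin n => fun ω => B (t i.succ) ω - B (t i.castSucc) ω) P)
    (hBgauss : ∀ s t : ℝ, 0 ≤ s → s ≤ t →
      Measure.map (fun ω => B t ω - B s ω) P = gaussianReal 0 (Real.toNNReal (t - s)))
    (hBcont : ∀ᵐ ω ∂P, Continuous fun t => B t ω)
    (m a : ℝ) (hm : 0 ≤ m) (ha : 0 < a)
    (τ : Ω → ℝ) (hτ : ∀ ω, τ ω = sInf {t : ℝ | 0 < t ∧ B t ω + m * t = a}) :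
    Measure.map (fun ω => (m * τ ω - a) ^ 2 / τ ω) P
      = (gaussianReal 0 1).map (fun z => z ^ 2) := by
  classical
  have hbad : P {ω | ¬ (B 0 ω = 0 ∧ Continuous fun t => B t ω)} = 0 := by
    have := hB0.and hBcont
    rwa [ae_iff] at this
  set N := toMeasurable P {ω | ¬ (B 0 ω = 0 ∧ Continuous fun t => B t ω)} with hN
  have hN0 : P N = 0 := by rw [hN, measure_toMeasurable, hbad]
  have hNm : MeasurableSet N := measurableSet_toMeasurable _ _
  have hNc : ∀ ω, ω ∉ N → B 0 ω = 0 ∧ Continuous fun t => B t ω := fun ω hω => by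
    by_contra hcon
    exact hω (subset_toMeasurable _ _ hcon)
  have hNae : ∀ᵐ ω ∂P, ω ∉ N := measure_eq_zero_iff_ae_notMem.1 hN0
  let C : NNReal → Ω → ℝ := fun t ω => if ω ∈ N then 0 else B t ω
  have hpre : IsPreBrownianReal (fun (t : NNReal) ω => B t ω) P := by
    refine HasIndepIncrements.isPreBrownianReal_of_hasLaw (fun t => ⟨(hBmeas t).aemeasurable, ?_⟩)
      (fun n t ht => ?_)
    · have h1 := hBgauss 0 t le_rfl t.2
      have h2 : (fun ω => B t ω) =ᵐ[P] (fun ω => B t ω - B 0 ω) := by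
        filter_upwards [hB0] with ω hω
        rw [hω, sub_zero]
      rw [Measure.map_congr h2, h1]
      simp
    · exact hBindep n (fun i => (t i : ℝ)) (fun i => (t i).2) (fun i j hij => by
        exact_mod_cast ht hij)
  have hC : HitChi.BM C P :=
    { pre := hpre.congr fun t => by
        filter_upwards [hNae] with ω hω
        simp [C, hω]
      meas := fun t => Measurable.ite hNm measurable_const (hBmeas t)
      cont := fun ω => by
        by_cases hω : ω ∈ N
        · simpa [C, hω] using continuous_const
        · simp only [C, hω, if_false]
          exact (hNc ω hω).2.comp NNReal.continuous_coe
      zero := fun ω => by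
        by_cases hω : ω ∈ N
        · simp [C, hω]
        · simpa [C, hω] using (hNc ω hω).1 }
  have hfin := hC.final hm ha
    (τ := fun ω => sInf {t : ℝ | 0 < t ∧ HitChi.W C m t.toNNReal ω = a}) (fun ω => rfl)
  rw [← hfin]
  refine Measure.map_congr ?_
  filter_upwards [hNae] with ω hω
  have : τ ω = sInf {t : ℝ | 0 < t ∧ HitChi.W C m t.toNNReal ω = a} := by
    rw [hτ]
    congr 1
    ext t
    refine and_congr_right fun ht => ?_
    simp [HitChi.W, C, hω, Real.coe_toNNReal _ ht.le]
  simp only [this]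

/-- For the first exit time `τ_b` of the drifted Brownian motion `X(t) = x + μ t + σ B_t`
over a barrier `b ≠ x` with `μ / (b − x) ≥ 0`, the random variable
`(μ τ_b − (b − x))² / (σ² τ_b)` has the `χ²(1)` distribution, i.e. the law of `Z²` for
`Z` standard normal. -/
theorem stmt1 {Ω : Type*} [MeasurableSpace Ω] (P : Measure Ω) [IsProbabilityMeasure P]
    (B : ℝ → Ω → ℝ)
    (hBmeas : ∀ t, Measurable (B t))
    (hB0 : ∀ᵐ ω ∂P, B 0 ω = 0)
    (hBindep : ∀ (n : ℕ) (t : Fin (n + 1) → ℝ), (∀ i, 0 ≤ t i) → Monotone t →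
      iIndepFun
        (fun i : Fin n => fun ω => B (t i.succ) ω - B (t i.castSucc) ω) P)
    (hBgauss : ∀ s t : ℝ, 0 ≤ s → s ≤ t →
      Measure.map (fun ω => B t ω - B s ω) P = gaussianReal 0 (Real.toNNReal (t - s)))
    (hBcont : ∀ᵐ ω ∂P, Continuous fun t => B t ω)
    (x b μ σ : ℝ) (hbx : b ≠ x) (hσ : 0 < σ) (hμ : 0 ≤ μ / (b - x))
    (X : ℝ → Ω → ℝ) (hX : ∀ t ω, X t ω = x + μ * t + σ * B t ω)
    (τ : Ω → ℝ) (hτ : ∀ ω, τ ω = sInf {t : ℝ | 0 < t ∧ X t ω = b}) :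
    Measure.map (fun ω => (μ * τ ω - (b - x)) ^ 2 / (σ ^ 2 * τ ω)) P
      = (gaussianReal 0 1).map (fun z => z ^ 2) := by
  have hba : b - x ≠ 0 := sub_ne_zero.2 hbx
  have hσ' : σ ≠ 0 := hσ.ne'
  have hform : ∀ ω, (μ * τ ω - (b - x)) ^ 2 / (σ ^ 2 * τ ω) =
      (μ / σ * τ ω - (b - x) / σ) ^ 2 / τ ω := fun ω => by
    have : μ / σ * τ ω - (b - x) / σ = (μ * τ ω - (b - x)) / σ := by ring
    rw [this, div_pow, div_div]
  simp_rw [hform]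
  rcases lt_or_gt_of_ne hba with hneg | hpos
  · have hm0 : μ ≤ 0 := by
      by_contra! hcon
      exact absurd hμ (not_le.2 (div_neg_of_pos_of_neg hcon hneg))
    have hform2 : ∀ ω, (μ / σ * τ ω - (b - x) / σ) ^ 2 / τ ω =
        (-μ / σ * τ ω - -(b - x) / σ) ^ 2 / τ ω := fun ω => by ring
    simp_rw [hform2]
    refine HitChi.pos_case P (fun t ω => - B t ω) (fun t => (hBmeas t).neg) ?_ ?_ ?_ ?_ _ _
      (div_nonneg (by linarith) hσ.le) (div_pos (by linarith) hσ) τ ?_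
    · filter_upwards [hB0] with ω hω
      simp [hω]
    · intro n t h0 ht
      have := (hBindep n t h0 ht).comp (fun _ y => -y) (fun _ => measurable_neg)
      convert this using 2
      ext ω
      simp
      ring
    · intro s t hs hst
      have h1 := hBgauss s t hs hst
      have h2 : (fun ω => - B t ω - - B s ω) = (fun y => -y) ∘ (fun ω => B t ω - B s ω) := by
        ext ω
        simp
        ring
      have h3 : Measurable (fun ω => B t ω - B s ω) := (hBmeas t).sub (hBmeas s)
      rw [h2, ← Measure.map_map (by fun_prop) h3, h1,
        gaussianReal_map_neg, neg_zero]
    · filter_upwards [hBcont] with ω hω using hω.neg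
    · intro ω
      rw [hτ]
      congr 1
      ext t
      refine and_congr_right fun _ => ?_
      rw [hX]
      constructor
      · intro h
        field_simp
        linarith
      · intro h
        field_simp at h
        linarith
  · have hm0 : 0 ≤ μ := by
      by_contra! hcon
      exact absurd hμ (not_le.2 (div_neg_of_neg_of_pos hcon hpos))
    refine HitChi.pos_case P B hBmeas hB0 hBindep hBgauss hBcont _ _
      (div_nonneg hm0 hσ.le) (div_pos hpos hσ) τ ?_
    intro ω
    rw [hτ]
    congr 1
    ext t
    refine and_congr_right fun _ => ?_
    rw [hX]
    constructor
    · intro h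
      field_simp
      linarith
    · intro h
      field_simp at h
      linarith
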